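/- Let M₁ = !![1, 0; 2, 1] and M₂ = !![1, 2; 0, 1] as 2×2 integer matrices. The monoid homomorphism from the free monoid on two generators (FreeMonoid Bool, say) to the multiplicative monoid of 2×2 integer matrices determined by sending one generator to M₁ and the other to M₂ is injective; in particular, M₁ and M₂ generate a free semigroup: any two distinct (possibly empty) words in M₁, M₂ have distinct products. -/

import Mathlib

/-- The integer matrix `M₁ = [[1,0],[2,1]]`. -/
def M1 : Matrix (Fin 2) (Fin 2) ℤ := !![1, 0; 2, 1]

/-- The integer matrix `M₂ = [[1,2],[0,1]]`. -/
def M2 : Matrix (Fin 2) (Fin 2) ℤ := !![1, 2; 0, 1]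

/-- The matrix product of a word in `M1` (`true`) and `M2` (`false`). -/
def wordMatrix : FreeMonoid Bool →* Matrix (Fin 2) (Fin 2) ℤ :=
  FreeMonoid.lift (fun b : Bool => if b then M1 else M2)

/-- The image of the vector `(1, 1)` under the matrix of a word. -/
def wordVec (w : FreeMonoid Bool) : Fin 2 → ℤ :=
  (wordMatrix w).mulVec ![1, 1]

theorem wordVec_one : wordVec 1 = ![1, 1] := by
  simp [wordVec]

theorem wordVec_of_true_mul (w : FreeMonoid Bool) :
    wordVec (FreeMonoid.of true * w) = ![wordVec w 0, 2 * wordVec w 0 + wordVec w 1] := by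
  rw [wordVec, map_mul, ← Matrix.mulVec_mulVec, ← wordVec]
  ext i
  fin_cases i <;> simp [wordMatrix, M1, Matrix.mulVec, dotProduct, Fin.sum_univ_two]

theorem wordVec_of_false_mul (w : FreeMonoid Bool) :
    wordVec (FreeMonoid.of false * w) = ![wordVec w 0 + 2 * wordVec w 1, wordVec w 1] := by
  rw [wordVec, map_mul, ← Matrix.mulVec_mulVec, ← wordVec]
  ext i
  fin_cases i <;> simp [wordMatrix, M2, Matrix.mulVec, dotProduct, Fin.sum_univ_two]

theorem wordVec_pos (w : FreeMonoid Bool) : 0 < wordVec w 0 ∧ 0 < wordVec w 1 := by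
  induction w using FreeMonoid.inductionOn' with
  | one => simp [wordVec_one]
  | of_mul b w ih =>
    cases b
    · simp only [wordVec_of_false_mul, Matrix.cons_val_zero, Matrix.cons_val_one]
      omega
    · simp only [wordVec_of_true_mul, Matrix.cons_val_zero, Matrix.cons_val_one]
      omega

/-- The first letter of a word is read off by comparing the two coordinates of its vector,
and the vector of the remaining word is then determined. -/
theorem wordVec_injective : Function.Injective wordVec := by
  intro u
  induction u using FreeMonoid.inductionOn' with
  | one =>
    intro v h
    induction v using FreeMonoid.inductionOn' with
    | one => rfl
    | of_mul c v _ =>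
      have hv := wordVec_pos v
      have h0 := congrFun h 0
      have h1 := congrFun h 1
      cases c <;> simp [wordVec_one, wordVec_of_true_mul, wordVec_of_false_mul] at h0 h1 <;> omega
  | of_mul b u ih =>
    intro v h
    have hu := wordVec_pos u
    have h0 := congrFun h 0
    have h1 := congrFun h 1
    induction v using FreeMonoid.inductionOn' with
    | one =>
      cases b <;> simp [wordVec_one, wordVec_of_true_mul, wordVec_of_false_mul] at h0 h1 <;> omega
    | of_mul c v _ =>
      have hv := wordVec_pos v
      have key : b = c ∧ wordVec u 0 = wordVec v 0 ∧ wordVec u 1 = wordVec v 1 := by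
        cases b <;> cases c <;>
          simp only [wordVec_of_true_mul, wordVec_of_false_mul, Matrix.cons_val_zero,
            Matrix.cons_val_one] at h0 h1 <;>
          simp only [true_and, reduceCtorEq, false_and] <;> omega
      obtain ⟨rfl, e0, e1⟩ := key
      rw [ih (funext (Fin.forall_fin_two.2 ⟨e0, e1⟩))]

/-- The monoid homomorphism from the free monoid on two generators to 2×2 integer
matrices sending the generators to `M₁` and `M₂` is injective; i.e. `M₁` and `M₂`
generate a free semigroup: distinct words in `M₁, M₂` have distinct products. -/
theorem stmt_7 :
    Function.Injective
      (FreeMonoid.lift (fun b : Bool => if b then M1 else M2) :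
        FreeMonoid Bool →* Matrix (Fin 2) (Fin 2) ℤ) := by
  intro u v h
  exact wordVec_injective (congrArg (fun A => A.mulVec ![1, 1]) h)
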